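/- For every p ∈ ℍ and every r > 0, the points q₁ = p and q₂ = p·(0, 0, r²/4) satisfy: q₁, q₂ ∈ B_{d_b}(p, r); d_b(q₁, q₂) = r/2 (in particular d_b(q₁,q₂) ≥ r/2); and for all p₁, p₂ ∈ ℍ with p₁, p₂ ∉ B_{d_b}(p, r) one has d_b(p₁, p₂) ≤ d_b(p₁, q₁) + d_b(p₂, q₂). (Hence (ℍ, d_b) satisfies the shortcut hypothesis of the shortening construction with λ = 1/2.) -/

import Mathlib

open scoped ENNReal

namespace Heis

/-- The underlying set of the Heisenberg group: `ℝ³`. -/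
abbrev H : Type := ℝ × ℝ × ℝ

/-- Heisenberg group multiplication. -/
noncomputable def Hmul (p q : H) : H :=
  (p.1 + q.1, p.2.1 + q.2.1, p.2.2 + q.2.2 + (p.1 * q.2.1 - p.2.1 * q.1) / 2)

/-- Heisenberg group inverse. -/
def Hinv (p : H) : H := (-p.1, -p.2.1, -p.2.2)

/-- The box norm `‖p‖ = max {|x|, |y|, √|z|}`. -/
noncomputable def boxNorm (p : H) : ℝ :=
  max |p.1| (max |p.2.1| (Real.sqrt |p.2.2|))

/-- The box distance `d_b(p,q) = ‖p⁻¹·q‖`. -/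
noncomputable def dbox (p q : H) : ℝ := boxNorm (Hmul (Hinv p) q)

/-- The dilations `δ_λ(x,y,z) = (λx, λy, λ²z)`. -/
noncomputable def dil (lam : ℝ) (p : H) : H := (lam * p.1, lam * p.2.1, lam ^ 2 * p.2.2)

/-- `d` is a distance (metric) on `X`. -/
def IsDistance {X : Type*} (d : X → X → ℝ) : Prop :=
  (∀ x y, d x y = d y x) ∧ (∀ x, d x x = 0) ∧
  (∀ x y, d x y = 0 → x = y) ∧ (∀ x y z, d x z ≤ d x y + d y z)

/-- The open ball of the distance function `d`. -/
def ballOf {X : Type*} (d : X → X → ℝ) (x : X) (r : ℝ) : Set X := {y | d x y < r}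

/-- The (extended) diameter of a set with respect to a distance function `d`. -/
noncomputable def ediamOf {X : Type*} (d : X → X → ℝ) (E : Set X) : ℝ≥0∞ :=
  ⨆ (x ∈ E) (y ∈ E), ENNReal.ofReal (d x y)

/-- The Hausdorff `Q`-measure of `A` with respect to the distance function `d`:
`H^Q_d(A) = lim_{ε→0} inf { Σᵢ (diam Eᵢ)^Q : A ⊆ ⋃ᵢ Eᵢ, diam Eᵢ ≤ ε }`. -/
noncomputable def hausdorffOf {X : Type*} (d : X → X → ℝ) (Q : ℝ) (A : Set X) : ℝ≥0∞ :=
  ⨆ (ε : ℝ≥0∞) (_ : 0 < ε),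
    ⨅ (E : ℕ → Set X) (_ : A ⊆ ⋃ n, E n) (_ : ∀ n, ediamOf d (E n) ≤ ε),
      ∑' n, ediamOf d (E n) ^ Q

/-- `(X, d)` is Ahlfors `Q`-regular: there is `C ≥ 1` with
`C⁻¹ r^Q ≤ H^Q_d(B_d(x,r)) ≤ C r^Q` for all `x` and `0 < r < diam X`. -/
def AhlforsRegularOf {X : Type*} (d : X → X → ℝ) (Q : ℝ) : Prop :=
  ∃ C : ℝ, 1 ≤ C ∧ ∀ (x : X) (r : ℝ), 0 < r → ENNReal.ofReal r < ediamOf d Set.univ →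
    ENNReal.ofReal (C⁻¹ * r ^ Q) ≤ hausdorffOf d Q (ballOf d x r) ∧
    hausdorffOf d Q (ballOf d x r) ≤ ENNReal.ofReal (C * r ^ Q)

/-- The distances `d` and `ρ` are biLipschitz equivalent on the set `A`. -/
def BiLipOn {X : Type*} (d ρ : X → X → ℝ) (A : Set X) : Prop :=
  ∃ L : ℝ, 1 ≤ L ∧ ∀ x ∈ A, ∀ y ∈ A, L⁻¹ * ρ x y ≤ d x y ∧ d x y ≤ L * ρ x y


lemma boxNorm_le_iff {p : H} {t : ℝ} (ht : 0 ≤ t) :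
    boxNorm p ≤ t ↔ |p.1| ≤ t ∧ |p.2.1| ≤ t ∧ |p.2.2| ≤ t ^ 2 := by
  simp only [boxNorm, max_le_iff, Real.sqrt_le_left ht]

lemma boxNorm_nonneg (p : H) : 0 ≤ boxNorm p :=
  (abs_nonneg _).trans (le_max_left _ _)

lemma boxNorm_bounds (p : H) :
    |p.1| ≤ boxNorm p ∧ |p.2.1| ≤ boxNorm p ∧ |p.2.2| ≤ boxNorm p ^ 2 :=
  (boxNorm_le_iff (boxNorm_nonneg p)).1 le_rfl

lemma boxNorm_vertical {r : ℝ} (hr : 0 ≤ r) : boxNorm (0, 0, r ^ 2 / 4) = r / 2 := by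
  have h : r ^ 2 / 4 = (r / 2) ^ 2 := by ring
  have h2 : 0 ≤ r / 2 := by positivity
  simp only [boxNorm, h, abs_zero, abs_of_nonneg (sq_nonneg (r / 2)), Real.sqrt_sq h2,
    max_eq_right h2]

lemma dbox_comm (p q : H) : dbox p q = dbox q p := by
  simp only [dbox, boxNorm, Hmul, Hinv]
  congr 1
  · rw [← abs_neg]; congr 1; ring
  congr 1
  · rw [← abs_neg]; congr 1; ring
  · rw [← abs_neg]; congr 2; ring

lemma dbox_mul_left (g p q : H) : dbox (Hmul g p) (Hmul g q) = dbox p q := by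
  simp only [dbox]
  congr 1
  ext <;> simp only [Hmul, Hinv] <;> ring

lemma Hinv_mul_cancel_left (p q : H) : Hmul (Hinv p) (Hmul p q) = q := by
  ext <;> simp only [Hmul, Hinv] <;> ring

/-- The distance from a point outside the ball of radius `r` around the identity to the vertical
point at height `r ^ 2 / 4` is at least `r / 2`. -/
lemma half_le_dbox_vertical {r : ℝ} (hr : 0 < r) {b : H} (hb : r ≤ boxNorm b) :
    r / 2 ≤ dbox b (0, 0, r ^ 2 / 4) := by
  by_contra! h
  obtain ⟨hx, hy, hz⟩ := (boxNorm_le_iff (by positivity)).1 h.le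
  simp only [Hmul, Hinv, add_zero, mul_zero, sub_zero, zero_div, abs_neg] at hx hy hz
  have hz' := abs_le.1 hz
  have hsq : 0 < r ^ 2 := by positivity
  have hb' : boxNorm b ≤ 3 / 4 * r := (boxNorm_le_iff (by positivity)).2
    ⟨by linarith, by linarith, abs_le.2 ⟨by nlinarith, by nlinarith⟩⟩
  linarith

lemma dbox_le_boxNorm_add_dbox_vertical {r : ℝ} (hr : 0 < r) {a b : H}
    (ha : r ≤ boxNorm a) (hb : r ≤ boxNorm b) :
    dbox a b ≤ boxNorm a + dbox b (0, 0, r ^ 2 / 4) := by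
  have hB := half_le_dbox_vertical hr hb
  obtain ⟨ax, ay, az⟩ := boxNorm_bounds a
  obtain ⟨bx, bys, bz⟩ := boxNorm_bounds (Hmul (Hinv b) (0, 0, r ^ 2 / 4))
  change _ ≤ dbox b _ at bx bys
  change _ ≤ dbox b _ ^ 2 at bz
  simp only [Hmul, Hinv, add_zero, mul_zero, sub_zero, zero_div, abs_neg] at bx bys bz
  generalize dbox b (0, 0, r ^ 2 / 4) = B at *
  generalize boxNorm a = A at *
  have hA0 : 0 ≤ A := by linarith
  have hxy : |a.1 * b.2.1| ≤ A * B := by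
    rw [abs_mul]; exact mul_le_mul ax bys (abs_nonneg _) hA0
  have hyx : |a.2.1 * b.1| ≤ A * B := by
    rw [abs_mul]; exact mul_le_mul ay bx (abs_nonneg _) hA0
  have hAB : r * (r / 2) ≤ A * B := mul_le_mul ha hB (by positivity) hA0
  have hsq : 0 < r ^ 2 := by positivity
  rw [abs_le] at ax ay az bx bys bz hxy hyx
  refine (boxNorm_le_iff (by linarith)).2 ⟨?_, ?_, ?_⟩ <;> simp only [Hmul, Hinv, abs_le] <;>
    constructor <;> nlinarith

/-- Vertical shortcuts in the Heisenberg group: `q₁ = p`,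
`q₂ = p·(0,0,r²/4)` satisfy the shortcut condition with `λ = 1/2`. -/
theorem statement9 (p : H) (r : ℝ) (hr : 0 < r) :
    p ∈ ballOf dbox p r ∧
    Hmul p ((0:ℝ), (0:ℝ), r ^ 2 / 4) ∈ ballOf dbox p r ∧
    dbox p (Hmul p ((0:ℝ), (0:ℝ), r ^ 2 / 4)) = r / 2 ∧
    ∀ p₁ p₂ : H, p₁ ∉ ballOf dbox p r → p₂ ∉ ballOf dbox p r →
      dbox p₁ p₂ ≤ dbox p₁ p + dbox p₂ (Hmul p ((0:ℝ), (0:ℝ), r ^ 2 / 4)) := by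
  have hq : dbox p (Hmul p ((0:ℝ), (0:ℝ), r ^ 2 / 4)) = r / 2 := by
    rw [dbox, Hinv_mul_cancel_left, boxNorm_vertical hr.le]
  refine ⟨?_, ?_, hq, fun p₁ p₂ h₁ h₂ => ?_⟩
  · have h : Hmul (Hinv p) p = (0, 0, 0) := by
      ext <;> simp only [Hmul, Hinv] <;> ring
    simpa [ballOf, dbox, h, boxNorm] using hr
  · change _ < r
    linarith
  · have h := dbox_le_boxNorm_add_dbox_vertical hr (not_lt.1 h₁) (not_lt.1 h₂)
    rwa [dbox_mul_left, ← Hinv_mul_cancel_left p (0, 0, r ^ 2 / 4), dbox_mul_left,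
      ← dbox, dbox_comm p p₁] at h

end Heis
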